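/- Let k ≥ 2, n ≥ 1, and let ξ ∈ S_{k−2} ⊗ S_{k−2} ⊗ V_{n−1} ⊗ V_{n−1} be a nonzero element with Φ^∨(ξ) = 0. If the lexicographically smallest index tuple at which ξ has a nonzero coordinate has the form (α, β, μ, ν) with both V-indices unbarred, then c(α, β, μ, ν) = c(α, β, ν, μ). -/

import Mathlib

open scoped TensorProduct
open MvPolynomial

noncomputable section

set_option maxHeartbeats 1000000
set_option synthInstance.maxHeartbeats 1000000

variable (K : Type) [Field K] [CharZero K]

set_option linter.unusedSectionVars false

/-- `S K m` is the space of homogeneous polynomials of degree `m` in the two variables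
`s = X 0` and `t = X 1`, with the convention `S K m = 0` for `m < 0`. -/
def S (m : ℤ) : Submodule K (MvPolynomial (Fin 2) K) :=
  if 0 ≤ m then homogeneousSubmodule (Fin 2) K m.toNat else ⊥

/-- The basis vector `s` of `U = S K 1`. -/
def sU : S K 1 := ⟨X 0, by
  simp only [S, if_pos (by norm_num : (0:ℤ) ≤ 1), Int.toNat_one, mem_homogeneousSubmodule]
  exact isHomogeneous_X _ _⟩

/-- The basis vector `t` of `U = S K 1`. -/
def tU : S K 1 := ⟨X 1, by
  simp only [S, if_pos (by norm_num : (0:ℤ) ≤ 1), Int.toNat_one, mem_homogeneousSubmodule]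
  exact isHomogeneous_X _ _⟩

lemma mul_mem_S {a b c : ℤ} (h : c = a + b) {p q : MvPolynomial (Fin 2) K}
    (hp : p ∈ S K a) (hq : q ∈ S K b) : p * q ∈ S K c := by
  by_cases ha : 0 ≤ a
  · by_cases hb : 0 ≤ b
    · have hc : 0 ≤ c := by omega
      simp only [S, if_pos ha, if_pos hb, if_pos hc, mem_homogeneousSubmodule] at *
      have e : c.toNat = a.toNat + b.toNat := by omega
      exact e ▸ hp.mul hq
    · simp only [S, if_neg hb, Submodule.mem_bot] at hq
      subst hq
      simp
  · simp only [S, if_neg ha, Submodule.mem_bot] at hp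
    subst hp
    simp

/-- Multiplication of homogeneous polynomials, `S K a × S K b → S K c` whenever `c = a + b`. -/
def mulP {a b c : ℤ} (h : c = a + b) (f : S K a) (g : S K b) : S K c :=
  ⟨(f : MvPolynomial (Fin 2) K) * g, mul_mem_S K h f.2 g.2⟩

/-- Multiplication by a linear form `u ∈ U = S K 1`, as a linear map `S K b →ₗ S K c`,
where `c = 1 + b`. -/
def mulLin {b c : ℤ} (h : c = 1 + b) (u : S K 1) : S K b →ₗ[K] S K c where
  toFun f := mulP K h u f
  map_add' f g := Subtype.ext (by simp [mulP, mul_add])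
  map_smul' r f := Subtype.ext (by simp [mulP, mul_smul_comm])

/-- `V K m = U ⊗ S K m` where `U = S K 1`; it is `0` for `m < 0`. -/
abbrev V (m : ℤ) := (S K 1) ⊗[K] (S K m)

/-- Multiplication by the linear form `u ∈ U` on `V K b`: `u • (w ⊗ h) = w ⊗ (u*h)`. -/
def VMul {b c : ℤ} (h : c = 1 + b) (u : S K 1) : V K b →ₗ[K] V K c :=
  LinearMap.lTensor (S K 1) (mulLin K h u)

section InstanceShortcuts

/-! Shortcut instances: Lean's instance search is very slow on iterated tensor products of
submodule coercions, so we register the instances for the shapes used below explicitly. -/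

set_option synthInstance.maxHeartbeats 1000000

noncomputable instance iAG2 (a b : ℤ) : AddCommGroup ((S K a) ⊗[K] (S K b)) := by
  exact TensorProduct.addCommGroup

noncomputable instance iAG3 (a b c : ℤ) :
    AddCommGroup ((S K a) ⊗[K] ((S K b) ⊗[K] (S K c))) := by
  exact TensorProduct.addCommGroup

noncomputable instance iAG4 (a b c d : ℤ) :
    AddCommGroup (((S K a) ⊗[K] (S K b)) ⊗[K] ((S K c) ⊗[K] (S K d))) := by
  exact TensorProduct.addCommGroup

noncomputable instance iAG5 (a b c d e : ℤ) :
    AddCommGroup ((S K a) ⊗[K] (((S K b) ⊗[K] (S K c)) ⊗[K] ((S K d) ⊗[K] (S K e)))) := by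
  exact TensorProduct.addCommGroup

noncomputable instance iAG6 (a b c d e f : ℤ) :
    AddCommGroup ((S K a) ⊗[K]
      ((S K b) ⊗[K] (((S K c) ⊗[K] (S K d)) ⊗[K] ((S K e) ⊗[K] (S K f))))) := by
  exact TensorProduct.addCommGroup

noncomputable instance iAGW (m : ℤ) : AddCommGroup ↥(⋀[K]^2 (V K m)) := by
  exact Submodule.addCommGroup _

noncomputable instance iAGSW (a m : ℤ) : AddCommGroup ((S K a) ⊗[K] ↥(⋀[K]^2 (V K m))) := by
  exact TensorProduct.addCommGroup

noncomputable instance iAGSSW (a b m : ℤ) :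
    AddCommGroup ((S K a) ⊗[K] ((S K b) ⊗[K] ↥(⋀[K]^2 (V K m)))) := by
  exact TensorProduct.addCommGroup

end InstanceShortcuts

/-- The wedge `v ∧ w` of two elements of `V K m`, in the exterior square `⋀[K]^2 (V K m)`. -/
def wedge {m : ℤ} (v w : V K m) : ⋀[K]^2 (V K m) :=
  ⟨ExteriorAlgebra.ιMulti K 2 ![v, w], ExteriorAlgebra.ιMulti_range K 2 (Set.mem_range_self _)⟩

/-- The coordinate functional on `S K m` w.r.t. the basis vector `s^(m-α) * t^α`
(the zero functional for out-of-range indices). -/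
def coeffS (m : ℤ) (α : ℤ) : S K m →ₗ[K] K :=
  if 0 ≤ α ∧ α ≤ m then
    (lcoeff K (Finsupp.single (0 : Fin 2) (m - α).toNat + Finsupp.single (1 : Fin 2) α.toNat)) ∘ₗ
      (S K m).subtype
  else 0

/-- The tensor product of two linear functionals, as a functional on the tensor product. -/
def tmulFun {M N : Type} [AddCommGroup M] [Module K M] [AddCommGroup N] [Module K N]
    (φ : M →ₗ[K] K) (ψ : N →ₗ[K] K) : M ⊗[K] N →ₗ[K] K :=
  (TensorProduct.lid K K).toLinearMap ∘ₗ TensorProduct.map φ ψ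

/-- An index for the basis of `V K m`: `(false, μ)` stands for the unbarred basis vector
`x_μ = s ⊗ s^(m-μ)t^μ` and `(true, μ)` for the barred basis vector `x̄_μ = t ⊗ s^(m-μ)t^μ`. -/
abbrev VIdx := Bool × ℤ

/-- The coordinate functional on `V K m` at the basis vector indexed by `ι : VIdx`. -/
def coeffV (m : ℤ) (ι : VIdx) : V K m →ₗ[K] K :=
  tmulFun K (coeffS K 1 (if ι.1 then 1 else 0)) (coeffS K m ι.2)

/-- The alternating bilinear form `(v, w) ↦ φ(v)ψ(w) - φ(w)ψ(v)` built from two functionals. -/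
def altForm {M : Type} [AddCommGroup M] [Module K M] (φ ψ : M →ₗ[K] K) :
    M [⋀^Fin 2]→ₗ[K] K :=
  MultilinearMap.alternatization
    ((MultilinearMap.mkPiAlgebra K (Fin 2) K).compLinearMap ![φ, ψ])

/-- The functional on `⋀[K]^2 M` induced by the alternating form `altForm φ ψ`.  For
dual-basis functionals `φ`, `ψ` of two basis vectors `e`, `f` of `M` this is the coordinate
functional at the basis vector `e ∧ f` of the exterior square. -/
def coLam {M : Type} [AddCommGroup M] [Module K M] (φ ψ : M →ₗ[K] K) :
    ⋀[K]^2 M →ₗ[K] K :=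
  (ExteriorAlgebra.liftAlternating
    (fun i => match i with | 2 => altForm K φ ψ | _ => 0)) ∘ₗ (⋀[K]^2 M).subtype

/-- The determinant form on `U = S K 1` normalized by `d(s,t) = 1`. -/
def detU (w w' : S K 1) : K :=
  coeffS K 1 0 w * coeffS K 1 1 w' - coeffS K 1 1 w * coeffS K 1 0 w'

/-- The domain `S_{k-2} ⊗ S_{k-2} ⊗ V_{n-1} ⊗ V_{n-1}` of the map `Φ^∨`. -/
abbrev PhiDom (k n : ℤ) :=
  (S K (k-2)) ⊗[K] ((S K (k-2)) ⊗[K] (V K (n-1) ⊗[K] V K (n-1)))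

/-- The codomain `S_{k-1} ⊗ S_{k-1} ⊗ Λ²V_n` of the map `Φ^∨`. -/
abbrev PhiCod (k n : ℤ) :=
  (S K (k-1)) ⊗[K] ((S K (k-1)) ⊗[K] ↥(⋀[K]^2 (V K n)))

/-- The domain `S_{k-3} ⊗ S_{k-3} ⊗ V_{n-2} ⊗ V_{n-2}` of the map `ε'`. -/
abbrev EpsDom (k n : ℤ) :=
  (S K (k-3)) ⊗[K] ((S K (k-3)) ⊗[K] (V K (n-2) ⊗[K] V K (n-2)))

/-- `Φ` is the map `Φ^∨` of the paper:
`Φ^∨(g ⊗ g' ⊗ v ⊗ v') = sg ⊗ sg' ⊗ (tv ∧ tv') − sg ⊗ tg' ⊗ (tv ∧ sv')`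
`− tg ⊗ sg' ⊗ (sv ∧ tv') + tg ⊗ tg' ⊗ (sv ∧ sv')`. -/
def IsPhi (k n : ℤ) (Φ : PhiDom K k n →ₗ[K] PhiCod K k n) : Prop :=
  let sk : S K (k-2) → S K (k-1) := mulP K (by ring) (sU K)
  let tk : S K (k-2) → S K (k-1) := mulP K (by ring) (tU K)
  let sn : V K (n-1) →ₗ[K] V K n := VMul K (by ring) (sU K)
  let tn : V K (n-1) →ₗ[K] V K n := VMul K (by ring) (tU K)
  ∀ (g g' : S K (k-2)) (v v' : V K (n-1)),
    Φ (g ⊗ₜ[K] (g' ⊗ₜ[K] (v ⊗ₜ[K] v'))) =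
        (sk g) ⊗ₜ[K] ((sk g') ⊗ₜ[K] (wedge K (tn v) (tn v')))
      - (sk g) ⊗ₜ[K] ((tk g') ⊗ₜ[K] (wedge K (tn v) (sn v')))
      - (tk g) ⊗ₜ[K] ((sk g') ⊗ₜ[K] (wedge K (sn v) (tn v')))
      + (tk g) ⊗ₜ[K] ((tk g') ⊗ₜ[K] (wedge K (sn v) (sn v')))

/-- `ε` is the map `ε'` of the paper:
`ε'(f ⊗ f' ⊗ u ⊗ u') = sf ⊗ sf' ⊗ tu ⊗ tu' − sf ⊗ tf' ⊗ su ⊗ tu'`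
`− tf ⊗ sf' ⊗ tu ⊗ su' + tf ⊗ tf' ⊗ su ⊗ su'`. -/
def IsEps (k n : ℤ) (ε : EpsDom K k n →ₗ[K] PhiDom K k n) : Prop :=
  let sk : S K (k-3) → S K (k-2) := mulP K (by ring) (sU K)
  let tk : S K (k-3) → S K (k-2) := mulP K (by ring) (tU K)
  let sn : V K (n-2) →ₗ[K] V K (n-1) := VMul K (by ring) (sU K)
  let tn : V K (n-2) →ₗ[K] V K (n-1) := VMul K (by ring) (tU K)
  ∀ (f f' : S K (k-3)) (u u' : V K (n-2)),
    ε (f ⊗ₜ[K] (f' ⊗ₜ[K] (u ⊗ₜ[K] u'))) =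
        (sk f) ⊗ₜ[K] ((sk f') ⊗ₜ[K] ((tn u) ⊗ₜ[K] (tn u')))
      - (sk f) ⊗ₜ[K] ((tk f') ⊗ₜ[K] ((sn u) ⊗ₜ[K] (tn u')))
      - (tk f) ⊗ₜ[K] ((sk f') ⊗ₜ[K] ((tn u) ⊗ₜ[K] (sn u')))
      + (tk f) ⊗ₜ[K] ((tk f') ⊗ₜ[K] ((sn u) ⊗ₜ[K] (sn u')))

/-- The coordinate `c(α, β, ι, κ)` of an element `ξ` of `S_{k-2} ⊗ S_{k-2} ⊗ V_{n-1} ⊗ V_{n-1}`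
at the basis vector `f_α ⊗ f_β ⊗ z_ι ⊗ z_κ`; it is `0` for out-of-range indices. -/
def cCoord (k n : ℤ) (ξ : PhiDom K k n) (α β : ℤ) (ι κ : VIdx) : K :=
  tmulFun K (coeffS K (k-2) α)
    (tmulFun K (coeffS K (k-2) β)
      (tmulFun K (coeffV K (n-1) ι) (coeffV K (n-1) κ))) ξ

/-- The coordinate of an element `η` of `S_{k-1} ⊗ S_{k-1} ⊗ Λ²V_n` at the basis vector
`g_α ⊗ g_β ⊗ (z_ι ∧ z_κ)` of the codomain of `Φ^∨`. -/
def dCoord (k n : ℤ) (η : PhiCod K k n) (α β : ℤ) (ι κ : VIdx) : K :=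
  tmulFun K (coeffS K (k-1) α)
    (tmulFun K (coeffS K (k-1) β)
      (coLam K (coeffV K n ι) (coeffV K n κ))) η

/-- Index tuples `(α, β, ι, κ)` for the coordinates of elements of
`S_{k-2} ⊗ S_{k-2} ⊗ V_{n-1} ⊗ V_{n-1}`. -/
abbrev Idx := ℤ × ℤ × VIdx × VIdx

/-- The order on `V`-indices: unbarred indices are compared among themselves by size, barred
indices among themselves by size, and every unbarred index precedes every barred index. -/
def vIdxLt : VIdx → VIdx → Prop := Prod.Lex (· < ·) (· < ·)

/-- The lexicographical order on index tuples. -/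
def idxLt : Idx → Idx → Prop :=
  Prod.Lex (· < ·) (Prod.Lex (· < ·) (Prod.Lex (vIdxLt) (vIdxLt)))

/-- `t` is the lexicographically smallest index tuple at which `ξ` has a nonzero coordinate. -/
def IsFirstNonzero (k n : ℤ) (ξ : PhiDom K k n) (t : Idx) : Prop :=
  cCoord K k n ξ t.1 t.2.1 t.2.2.1 t.2.2.2 ≠ 0 ∧
  ∀ t' : Idx, idxLt t' t → cCoord K k n ξ t'.1 t'.2.1 t'.2.2.1 t'.2.2.2 = 0

lemma tmulFun_tmul {M N : Type} [AddCommGroup M] [Module K M] [AddCommGroup N] [Module K N]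
    (φ : M →ₗ[K] K) (ψ : N →ₗ[K] K) (x : M) (y : N) :
    tmulFun K φ ψ (x ⊗ₜ[K] y) = φ x * ψ y := by
  simp [tmulFun]

lemma coeffS_s {b c : ℤ} (h : c = 1 + b) (g : S K b) (a : ℤ) :
    coeffS K c a (mulP K h (sU K) g) = coeffS K b a g := by
  unfold coeffS
  by_cases h1 : 0 ≤ a ∧ a ≤ b
  · rw [if_pos h1, if_pos (by omega)]
    have e : (c - a).toNat = 1 + (b - a).toNat := by omega
    simp only [LinearMap.comp_apply, Submodule.subtype_apply, lcoeff_apply, mulP, sU, e,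
      Finsupp.single_add, add_assoc]
    rw [coeff_X_mul]
  · rw [if_neg h1]
    split_ifs with h2
    · have e : (c - a).toNat = 0 := by omega
      simp only [LinearMap.comp_apply, Submodule.subtype_apply, lcoeff_apply, mulP, sU, e]
      rw [coeff_X_mul']
      simp
    · simp

lemma coeffS_t {b c : ℤ} (h : c = 1 + b) (g : S K b) (a : ℤ) :
    coeffS K c a (mulP K h (tU K) g) = coeffS K b (a - 1) g := by
  unfold coeffS
  by_cases h1 : 0 ≤ a - 1 ∧ a - 1 ≤ b
  · rw [if_pos h1, if_pos (by omega)]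
    have e : a.toNat = 1 + (a - 1).toNat := by omega
    have e' : (b - (a - 1)) = c - a := by omega
    simp only [LinearMap.comp_apply, Submodule.subtype_apply, lcoeff_apply, mulP, tU, e, e',
      Finsupp.single_add]
    rw [add_left_comm, coeff_X_mul]
  · rw [if_neg h1]
    split_ifs with h2
    · have e : a.toNat = 0 := by omega
      simp only [LinearMap.comp_apply, Submodule.subtype_apply, lcoeff_apply, mulP, tU, e]
      rw [coeff_X_mul']
      simp
    · simp

lemma coeffV_s {b c : ℤ} (h : c = 1 + b) (v : V K b) (x : Bool) (a : ℤ) :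
    coeffV K c (x, a) (VMul K h (sU K) v) = coeffV K b (x, a) v := by
  induction v using TensorProduct.induction_on with
  | zero => simp
  | tmul w g =>
    simp only [coeffV, VMul, LinearMap.lTensor_tmul, tmulFun_tmul]
    congr 1
    exact coeffS_s K h g a
  | add u v hu hv => rw [map_add, map_add, map_add, hu, hv]

lemma coeffV_t {b c : ℤ} (h : c = 1 + b) (v : V K b) (x : Bool) (a : ℤ) :
    coeffV K c (x, a) (VMul K h (tU K) v) = coeffV K b (x, a - 1) v := by
  induction v using TensorProduct.induction_on with
  | zero => simp
  | tmul w g =>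
    simp only [coeffV, VMul, LinearMap.lTensor_tmul, tmulFun_tmul]
    congr 1
    exact coeffS_t K h g a
  | add u v hu hv => rw [map_add, map_add, map_add, hu, hv]

lemma coLam_wedge {m : ℤ} (φ ψ : V K m →ₗ[K] K) (v w : V K m) :
    coLam K φ ψ (wedge K v w) = φ v * ψ w - φ w * ψ v := by
  simp only [coLam, wedge, LinearMap.comp_apply, Submodule.subtype_apply]
  rw [ExteriorAlgebra.liftAlternating_apply_ιMulti]
  have hu : (Finset.univ : Finset (Equiv.Perm (Fin 2))) = {1, Equiv.swap 0 1} := by decide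
  have hne : (1 : Equiv.Perm (Fin 2)) ≠ Equiv.swap 0 1 := by decide
  simp only [altForm, MultilinearMap.alternatization_apply]
  rw [hu, Finset.sum_pair hne]
  simp [Fin.prod_univ_two]
  ring

lemma dCoord_phi (k n : ℤ) (Φ : PhiDom K k n →ₗ[K] PhiCod K k n) (hΦ : IsPhi K k n Φ)
    (α β μ ν : ℤ) (ξ : PhiDom K k n) :
    dCoord K k n (Φ ξ) α β (false, μ + 1) (false, ν + 1) =
      (cCoord K k n ξ α β (false, μ) (false, ν) - cCoord K k n ξ α β (false, ν) (false, μ))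
      - (cCoord K k n ξ α (β-1) (false, μ) (false, ν+1)
          - cCoord K k n ξ α (β-1) (false, ν) (false, μ+1))
      - (cCoord K k n ξ (α-1) β (false, μ+1) (false, ν)
          - cCoord K k n ξ (α-1) β (false, ν+1) (false, μ))
      + (cCoord K k n ξ (α-1) (β-1) (false, μ+1) (false, ν+1)
          - cCoord K k n ξ (α-1) (β-1) (false, ν+1) (false, μ+1)) := by
  unfold dCoord cCoord
  induction ξ using TensorProduct.induction_on with
  | zero => simp
  | add x y hx hy => simp only [map_add, hx, hy]; ring
  | tmul g y =>
    induction y using TensorProduct.induction_on with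
    | zero => simp
    | add x y hx hy => simp only [TensorProduct.tmul_add, map_add, hx, hy]; ring
    | tmul g' y =>
      induction y using TensorProduct.induction_on with
      | zero => simp
      | add x y hx hy => simp only [TensorProduct.tmul_add, map_add, hx, hy]; ring
      | tmul v v' =>
        rw [hΦ g g' v v']
        simp only [map_add, map_sub, tmulFun_tmul, coLam_wedge, coeffV_s, coeffV_t,
          coeffS_s, coeffS_t, add_sub_cancel_right]
        ring

/-- Let `k ≥ 2`, `n ≥ 1`, and let `ξ` be a nonzero element of
`S_{k−2} ⊗ S_{k−2} ⊗ V_{n−1} ⊗ V_{n−1}` with `Φ^∨(ξ) = 0`. If the lexicographically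
smallest index tuple at which `ξ` has a nonzero coordinate has the form `(α, β, μ, ν)`
with both `V`-indices unbarred, then `c(α, β, μ, ν) = c(α, β, ν, μ)`. -/
theorem statement13 (K : Type) [Field K] [CharZero K] (k n : ℤ) (hk : 2 ≤ k) (hn : 1 ≤ n)
    (ξ : PhiDom K k n) (hξ : ξ ≠ 0)
    (Φ : PhiDom K k n →ₗ[K] PhiCod K k n) (hΦ : IsPhi K k n Φ) (hker : Φ ξ = 0)
    (α β μ ν : ℤ)
    (hfirst : IsFirstNonzero K k n ξ (α, β, (false, μ), (false, ν))) :
    cCoord K k n ξ α β (false, μ) (false, ν) = cCoord K k n ξ α β (false, ν) (false, μ) := by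
  have h := dCoord_phi K k n Φ hΦ α β μ ν ξ
  obtain ⟨-, h0⟩ := hfirst
  have hA : ∀ b ι κ, cCoord K k n ξ (α-1) b ι κ = 0 := fun b ι κ =>
    h0 (α-1, b, ι, κ) (Prod.Lex.left _ _ (by omega))
  have hB : ∀ ι κ, cCoord K k n ξ α (β-1) ι κ = 0 := fun ι κ =>
    h0 (α, β-1, ι, κ) (Prod.Lex.right _ (Prod.Lex.left _ _ (by omega)))
  have hz : dCoord K k n (Φ ξ) α β (false, μ + 1) (false, ν + 1) = 0 := by
    rw [hker, dCoord, map_zero]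
  rw [hz] at h
  simp only [hA, hB, sub_zero, add_zero] at h
  exact sub_eq_zero.mp h.symm
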